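/- Let C ⊂ 𝕋² be a smooth curve with nowhere-vanishing curvature. There exist constants c > 0 and λ₀ > 0, depending only on C, such that for every λ ≥ λ₀ and every nonzero real-valued eigenfunction F of the Laplacian on 𝕋² with eigenvalue λ², one has ∫_C |F| ≥ c·‖F‖₂/√(#E_λ), where #E_λ is the number of lattice points on the circle of radius λ. -/

import Mathlib

open MeasureTheory Real

noncomputable section

/-- The Euclidean norm of a vector in `ℝ × ℝ`. -/
def e2 (x : ℝ × ℝ) : ℝ := Real.sqrt (x.1 ^ 2 + x.2 ^ 2)

/-- The integer vector `μ` viewed as a vector in `ℝ × ℝ`. -/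
def iv (μ : ℤ × ℤ) : ℝ × ℝ := ((μ.1 : ℝ), (μ.2 : ℝ))

/-- The set of lattice points on the circle of radius `lam`. -/
def Elat (lam : ℝ) : Finset (ℤ × ℤ) := by
  classical
  exact (Finset.Icc (-⌈lam⌉, -⌈lam⌉) (⌈lam⌉, ⌈lam⌉)).filter
    (fun μ => (μ.1 : ℝ) ^ 2 + (μ.2 : ℝ) ^ 2 = lam ^ 2)

/-- `B_lam`: the maximal number of lattice points on the circle of radius `lam`
lying in an arc of length `√lam`. -/
def Bmax (lam : ℝ) : ℕ := by
  classical
  exact sSup {n : ℕ | ∃ x : ℝ × ℝ, e2 x = lam ∧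
    n = ((Elat lam).filter fun ξ => e2 (iv ξ - x) ≤ Real.sqrt lam).card}

/-- The eigenfunction `F(x) = ∑_{μ ∈ E_lam} a_μ e^{i⟨μ,x⟩}` of the Laplacian on the torus
`ℝ²/(2πℤ²)` with eigenvalue `lam²`. -/
def efn (lam : ℝ) (a : ℤ × ℤ → ℂ) (x : ℝ × ℝ) : ℂ :=
  ∑ μ ∈ Elat lam, a μ *
    Complex.exp (Complex.I * Complex.ofReal ((μ.1 : ℝ) * x.1 + (μ.2 : ℝ) * x.2))

/-- The `L²` norm of `F` over the torus, realized as the square `[0,2π]²`. -/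
def l2T (F : ℝ × ℝ → ℂ) : ℝ :=
  Real.sqrt (∫ x in (Set.Icc (0:ℝ) (2 * π)) ×ˢ (Set.Icc (0:ℝ) (2 * π)), ‖F x‖ ^ 2)

lemma finite_gaussianInt_norm_eq (n : ℕ) : {z : GaussianInt | z.norm = n}.Finite := by
  have h : Set.InjOn (fun z : GaussianInt => (z.re, z.im)) {z : GaussianInt | z.norm = n} := by
    intro z _ w _ hzw
    exact Zsqrtd.ext (congrArg Prod.fst hzw) (congrArg Prod.snd hzw)
  refine Set.Finite.of_finite_image
    ((Set.finite_Icc ((-n : ℤ), (-n : ℤ)) ((n : ℤ), (n : ℤ))).subset ?_) h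
  rintro _ ⟨z, hz, rfl⟩
  simp only [Set.mem_ofPred_eq, Zsqrtd.norm_def] at hz
  simp only [Set.mem_Icc, Prod.mk_le_mk]
  refine ⟨⟨?_, ?_⟩, ?_, ?_⟩ <;>
    nlinarith [sq_nonneg z.re, sq_nonneg z.im, Int.le_self_sq z.re, Int.le_self_sq z.im,
      Int.le_self_sq (-z.re), Int.le_self_sq (-z.im)]

lemma GaussianInt.dvd_norm (z : GaussianInt) : z ∣ (z.norm : GaussianInt) :=
  ⟨star z, Zsqrtd.norm_eq_mul_conj z⟩

lemma ncard_gaussianInt_norm_eq_mul_le {a b : ℕ} (hab : a.Coprime b) :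
    {z : GaussianInt | z.norm = (a * b : ℕ)}.ncard ≤
      {z : GaussianInt | z.norm = a}.ncard * {z : GaussianInt | z.norm = b}.ncard := by
  rw [← Set.ncard_prod]
  refine (Set.ncard_le_ncard (t := (fun p : GaussianInt × GaussianInt => p.1 * p.2) '' _) ?_
    (((finite_gaussianInt_norm_eq a).prod (finite_gaussianInt_norm_eq b)).image _)).trans
    (Set.ncard_image_le ((finite_gaussianInt_norm_eq a).prod (finite_gaussianInt_norm_eq b)))
  intro z hz
  have hz' : z.norm = (a * b : ℕ) := hz
  have hd : z ∣ (a : GaussianInt) * (b : GaussianInt) := by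
    have := GaussianInt.dvd_norm z
    rw [hz'] at this
    push_cast at this
    exact this
  obtain ⟨u, w, hu, hw, rfl⟩ := exists_dvd_and_dvd_of_dvd_mul hd
  obtain ⟨u', hu'⟩ := hu
  obtain ⟨w', hw'⟩ := hw
  have h1 : u.norm * u'.norm = (a : ℤ) * a := by
    rw [← Zsqrtd.norm_mul, ← hu', Zsqrtd.norm_natCast]
  have h2 : w.norm * w'.norm = (b : ℤ) * b := by
    rw [← Zsqrtd.norm_mul, ← hw', Zsqrtd.norm_natCast]
  rw [Zsqrtd.norm_mul] at hz'
  have hun := GaussianInt.norm_nonneg u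
  have hwn := GaussianInt.norm_nonneg w
  lift u.norm to ℕ using hun with x hx
  lift w.norm to ℕ using hwn with y hy
  have hxy : x * y = a * b := by exact_mod_cast hz'
  have hxa : x ∣ a * a := by
    have : (x : ℤ) ∣ ((a * a : ℕ) : ℤ) := ⟨_, by push_cast; exact h1.symm⟩
    exact_mod_cast this
  have hyb : y ∣ b * b := by
    have : (y : ℤ) ∣ ((b * b : ℕ) : ℤ) := ⟨_, by push_cast; exact h2.symm⟩
    exact_mod_cast this
  have hxb : x.Coprime b := Nat.Coprime.coprime_dvd_left hxa (Nat.Coprime.mul_left hab hab)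
  have hya : y.Coprime a :=
    Nat.Coprime.coprime_dvd_left hyb (Nat.Coprime.mul_left hab.symm hab.symm)
  have e1 : x = a := Nat.dvd_antisymm
    (hxb.dvd_of_dvd_mul_right (hxy ▸ Dvd.intro _ rfl))
    (hya.symm.dvd_of_dvd_mul_right (hxy ▸ Dvd.intro _ rfl))
  have e2 : y = b := Nat.dvd_antisymm
    (hya.dvd_of_dvd_mul_left (hxy ▸ Dvd.intro_left _ rfl))
    (hxb.symm.dvd_of_dvd_mul_left (hxy ▸ Dvd.intro_left _ rfl))
  exact ⟨(u, w), ⟨by simp [← hx, e1], by simp [← hy, e2]⟩, rfl⟩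

lemma GaussianInt.isUnit_iff_norm_eq_one {z : GaussianInt} : IsUnit z ↔ z.norm = 1 := by
  rw [← Zsqrtd.norm_eq_one_iff]
  have := GaussianInt.norm_nonneg z
  omega

lemma GaussianInt.exists_prime_mul_eq {p : ℕ} (hp : p.Prime) :
    ∃ q r : GaussianInt, (p : GaussianInt) = q * r ∧ Prime q ∧ (Prime r ∨ IsUnit r) := by
  have hpn : ((p : GaussianInt)).norm = (p : ℤ) * p := Zsqrtd.norm_natCast p
  have hp2 := hp.two_le
  have hnu : ¬ IsUnit (p : GaussianInt) := by
    rw [GaussianInt.isUnit_iff_norm_eq_one, hpn]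
    intro h
    have : p * p = 1 := by exact_mod_cast h
    nlinarith
  have hp0 : (p : GaussianInt) ≠ 0 := by
    intro h
    rw [h] at hpn
    simp at hpn
    omega
  obtain ⟨q, hq, r, hr⟩ := WfDvdMonoid.exists_irreducible_factor hnu hp0
  refine ⟨q, r, hr, hq.prime, ?_⟩
  by_contra! hcon
  obtain ⟨hrp, hru⟩ := hcon
  have hs0 : r ≠ 0 := by
    rintro rfl
    exact hp0 (by simpa using hr)
  obtain ⟨ρ, hρ, τ, hτ⟩ := WfDvdMonoid.exists_irreducible_factor hru hs0
  have hτu : ¬ IsUnit τ := by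
    intro h
    apply hrp
    have : Associated ρ r := ⟨h.unit, by simp [hτ]⟩
    exact this.prime hρ.prime
  have hn : q.norm * (ρ.norm * τ.norm) = (p : ℤ) * p := by
    rw [← Zsqrtd.norm_mul, ← Zsqrtd.norm_mul, ← hτ, ← hr, hpn]
  have h1 : q.norm ≠ 1 := fun h => hq.not_isUnit (GaussianInt.isUnit_iff_norm_eq_one.2 h)
  have h2 : ρ.norm ≠ 1 := fun h => hρ.not_isUnit (GaussianInt.isUnit_iff_norm_eq_one.2 h)
  have h3 : τ.norm ≠ 1 := fun h => hτu (GaussianInt.isUnit_iff_norm_eq_one.2 h)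
  have n1 := GaussianInt.norm_nonneg q
  have n2 := GaussianInt.norm_nonneg ρ
  have n3 := GaussianInt.norm_nonneg τ
  lift q.norm to ℕ using n1 with x
  lift ρ.norm to ℕ using n2 with y
  lift τ.norm to ℕ using n3 with z
  have hn' : x * (y * z) = p ^ 2 := by rw [pow_two]; exact_mod_cast hn
  have key : ∀ d : ℕ, d ∣ p ^ 2 → (d : ℤ) ≠ 1 → p ∣ d := by
    intro d hd hd1
    obtain ⟨k, hk, rfl⟩ := (Nat.dvd_prime_pow hp).1 hd
    rcases k with _ | k
    · simp at hd1
    · exact dvd_pow_self _ (by omega)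
  have hx := key x ⟨_, hn'.symm⟩ h1
  have hy := key y ⟨x * z, by rw [← hn']; ring⟩ h2
  have hz := key z ⟨x * y, by rw [← hn']; ring⟩ h3
  have h : p ^ 3 ∣ p ^ 2 := by
    rw [← hn']
    exact (show p ^ 3 = p * (p * p) by ring) ▸ mul_dvd_mul hx (mul_dvd_mul hy hz)
  have := (Nat.pow_dvd_pow_iff_le_right hp2).1 h
  omega

lemma ncard_gaussianInt_norm_eq_prime_pow_le {p : ℕ} (hp : p.Prime) (k : ℕ) :
    {z : GaussianInt | z.norm = (p ^ k : ℕ)}.ncard ≤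
      {z : GaussianInt | z.norm = (1 : ℕ)}.ncard * (k + 1) ^ 2 := by
  obtain ⟨q, r, hpe, hq, hr⟩ := GaussianInt.exists_prime_mul_eq hp
  have hr' : ∀ w : GaussianInt, w ∣ r ^ k → ∃ j ≤ k, Associated w (r ^ j) := by
    intro w hw
    rcases hr with hr | hr
    · exact (dvd_prime_pow hr k).1 hw
    · exact ⟨0, Nat.zero_le _, by
        rw [pow_zero]
        exact associated_one_iff_isUnit.2 (isUnit_of_dvd_unit hw (hr.pow k))⟩
  let S : Set (GaussianInt × ℕ × ℕ) :=
    {z : GaussianInt | z.norm = (1 : ℕ)} ×ˢ (Set.Iic k ×ˢ Set.Iic k)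
  have hS : S.Finite := (finite_gaussianInt_norm_eq 1).prod
    ((Set.finite_Iic k).prod (Set.finite_Iic k))
  have hcard : S.ncard = {z : GaussianInt | z.norm = (1 : ℕ)}.ncard * (k + 1) ^ 2 := by
    have : (Set.Iic k).ncard = k + 1 := by
      rw [← Finset.coe_Iic, Set.ncard_coe_finset]; simp
    rw [Set.ncard_prod, Set.ncard_prod, this, pow_two]
  rw [← hcard]
  refine (Set.ncard_le_ncard
    (t := (fun x : GaussianInt × ℕ × ℕ => q ^ x.2.1 * r ^ x.2.2 * x.1) '' S) ?_
    (hS.image _)).trans (Set.ncard_image_le hS)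
  intro z hz
  have hd : z ∣ q ^ k * r ^ k := by
    have := GaussianInt.dvd_norm z
    rw [show z.norm = (p ^ k : ℕ) from hz] at this
    push_cast at this
    rwa [hpe, mul_pow] at this
  obtain ⟨u, w, hu, hw, rfl⟩ := exists_dvd_and_dvd_of_dvd_mul hd
  obtain ⟨i, hi, hui⟩ := (dvd_prime_pow hq k).1 hu
  obtain ⟨j, hj, hwj⟩ := hr' w hw
  obtain ⟨v, hv⟩ := (hui.mul_mul hwj).symm
  refine ⟨(v, i, j), ⟨?_, hi, hj⟩, hv⟩
  simpa using GaussianInt.isUnit_iff_norm_eq_one.1 v.isUnit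

lemma exists_ncard_gaussianInt_norm_eq_le_rpow {ε : ℝ} (hε : 0 < ε) :
    ∃ C : ℝ, 0 < C ∧ ∀ n : ℕ, 0 < n →
      ({z : GaussianInt | z.norm = n}.ncard : ℝ) ≤ C * (n : ℝ) ^ ε := by
  set U : ℕ := {z : GaussianInt | z.norm = (1 : ℕ)}.ncard with hU
  have hU1 : 1 ≤ U := by
    exact (Set.ncard_pos (finite_gaussianInt_norm_eq 1)).2 ⟨1, by simp⟩
  obtain ⟨A, hA1, hA⟩ : ∃ A : ℝ, 1 ≤ A ∧
      ∀ k : ℕ, (U : ℝ) * (k + 1) ^ 2 ≤ A * ((2 : ℝ) ^ ε) ^ k := by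
    have h2 : 1 < (2 : ℝ) ^ ε := Real.one_lt_rpow one_lt_two hε
    have ht := (tendsto_pow_const_div_const_pow_of_one_lt 2 h2).comp
      (Filter.tendsto_add_atTop_nat 1)
    obtain ⟨B, hB⟩ := ht.bddAbove_range
    refine ⟨max 1 (U * (B * (2 : ℝ) ^ ε)), le_max_left _ _, fun k => ?_⟩
    have hk := hB ⟨k, rfl⟩
    simp only [Function.comp_apply] at hk
    rw [div_le_iff₀ (by positivity)] at hk
    push_cast at hk
    calc (U : ℝ) * (k + 1) ^ 2 ≤ U * (B * ((2 : ℝ) ^ ε) ^ (k + 1)) := by gcongr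
      _ = (U * (B * (2 : ℝ) ^ ε)) * ((2 : ℝ) ^ ε) ^ k := by ring
      _ ≤ _ := by gcongr; exact le_max_right _ _
  obtain ⟨P, hP⟩ : ∃ P : ℕ, ∀ p : ℕ, P ≤ p → 4 * (U : ℝ) ≤ (p : ℝ) ^ ε := by
    have := ((tendsto_rpow_atTop hε).comp tendsto_natCast_atTop_atTop).eventually_ge_atTop
      (4 * (U : ℝ))
    exact Filter.eventually_atTop.1 this
  let g : ℕ → ℝ := fun p => if p < P then A else 1
  have hg1 : ∀ p, 1 ≤ g p := by
    intro p
    simp only [g]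
    split_ifs <;> linarith
  have key : ∀ n : ℕ, 1 < n → ({z : GaussianInt | z.norm = n}.ncard : ℝ) ≤
      (∏ p ∈ n.primeFactors, g p) * (n : ℝ) ^ ε := by
    intro n
    induction n using Nat.recOnPosPrimePosCoprime with
    | zero => intro h; omega
    | one => intro h; omega
    | prime_pow p k hp hk =>
      intro _
      rw [Nat.primeFactors_prime_pow hk.ne' hp, Finset.prod_singleton]
      have h1 : ({z : GaussianInt | z.norm = (p ^ k : ℕ)}.ncard : ℝ) ≤ U * (k + 1) ^ 2 := by
        exact_mod_cast ncard_gaussianInt_norm_eq_prime_pow_le hp k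
      refine h1.trans ?_
      have hpk : ((p ^ k : ℕ) : ℝ) ^ ε = ((p : ℝ) ^ ε) ^ k := by
        rw [Nat.cast_pow, ← Real.rpow_natCast, ← Real.rpow_mul (by positivity), mul_comm,
          Real.rpow_mul (by positivity), Real.rpow_natCast]
      rw [hpk]
      simp only [g]
      split_ifs with hpP
      · refine (hA k).trans ?_
        have : (2 : ℝ) ≤ p := by exact_mod_cast hp.two_le
        gcongr
      · rw [one_mul]
        have hk2 : (k : ℝ) + 1 ≤ 2 ^ k := by exact_mod_cast Nat.lt_two_pow_self (n := k)
        have hU1' : (1 : ℝ) ≤ U := by exact_mod_cast hU1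
        calc (U : ℝ) * ((k : ℝ) + 1) ^ 2 ≤ (U : ℝ) ^ k * ((2 : ℝ) ^ k) ^ 2 := by
              gcongr
              exact le_self_pow₀ hU1' hk.ne'
          _ = (4 * (U : ℝ)) ^ k := by rw [mul_pow, ← pow_mul, mul_comm k 2, pow_mul]; norm_num; ring
          _ ≤ _ := by
              gcongr
              exact hP p (not_lt.1 hpP)
    | coprime a b ha hb hab iha ihb =>
      intro _
      have h1 : ({z : GaussianInt | z.norm = (a * b : ℕ)}.ncard : ℝ) ≤
          {z : GaussianInt | z.norm = a}.ncard * {z : GaussianInt | z.norm = b}.ncard := by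
        exact_mod_cast ncard_gaussianInt_norm_eq_mul_le hab
      rw [hab.primeFactors_mul, Finset.prod_union hab.disjoint_primeFactors,
        Nat.cast_mul (α := ℝ), Real.mul_rpow (by positivity) (by positivity)]
      refine h1.trans ((mul_le_mul (iha ha) (ihb hb) (by positivity) ?_).trans_eq (by ring))
      have := Finset.prod_nonneg fun p (_ : p ∈ a.primeFactors) => zero_le_one.trans (hg1 p)
      positivity
  refine ⟨U + A ^ P, by positivity, fun n hn => ?_⟩
  have hnε : (1 : ℝ) ≤ (n : ℝ) ^ ε :=
    Real.one_le_rpow (by exact_mod_cast hn) hε.le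
  have hAP : (0 : ℝ) < A ^ P := by positivity
  rcases Nat.eq_or_lt_of_le (Nat.succ_le_of_lt hn) with rfl | hn1
  · simp only [Nat.succ_eq_add_one, zero_add, Nat.cast_one, Real.one_rpow, mul_one]
    simp only [hU, Nat.cast_one]
    linarith
  · refine (key n hn1).trans ?_
    gcongr
    have hprod : ∏ p ∈ n.primeFactors, g p ≤ A ^ P := by
      calc ∏ p ∈ n.primeFactors, g p = ∏ p ∈ n.primeFactors with p < P, A := by
            rw [Finset.prod_filter]
        _ = A ^ (n.primeFactors.filter (· < P)).card := Finset.prod_const A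
        _ ≤ A ^ P := by
            refine pow_le_pow_right₀ hA1 ?_
            refine (Finset.card_le_card (t := Finset.range P) ?_).trans_eq (Finset.card_range P)
            intro p hp
            simpa using (Finset.mem_filter.1 hp).2
    have : (0 : ℝ) ≤ U := by positivity
    linarith

lemma integral_inv_one_add_sq_mul_sq_le {u v w : ℝ → ℝ} {L B K M s : ℝ} (hL : 0 ≤ L) (hB : 0 ≤ B)
    (hu : ∀ t, HasDerivAt u (v t) t) (hv : ∀ t, HasDerivAt v (w t) t) (hw : Continuous w)
    (hK : ∀ t ∈ Set.Icc 0 L, |v t| ≤ K) (hM : ∀ t ∈ Set.Icc 0 L, |w t| ≤ M)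
    (huv : ∀ t ∈ Set.Icc 0 L, 1 ≤ u t ^ 2 + B * v t ^ 2) (hs : 1 ≤ s) :
    ∫ t in (0:ℝ)..L, (1 + s ^ 2 * u t ^ 2)⁻¹ ≤ (L + B * (π * (K + L * M))) / s := by
  have hs0 : 0 < s := by linarith
  have huc : Continuous u := continuous_iff_continuousAt.2 fun t => (hu t).continuousAt
  have hvc : Continuous v := continuous_iff_continuousAt.2 fun t => (hv t).continuousAt
  have hq : ∀ t, 0 < 1 + s ^ 2 * u t ^ 2 := fun t => by positivity
  have hqc : Continuous fun t => (1 + s ^ 2 * u t ^ 2)⁻¹ :=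
    Continuous.inv₀ (by fun_prop) fun t => (hq t).ne'
  have hK0 : 0 ≤ K := (abs_nonneg _).trans (hK 0 ⟨le_rfl, hL⟩)
  have harc : ∀ t, HasDerivAt (fun t => arctan (s * u t))
      ((1 + s ^ 2 * u t ^ 2)⁻¹ * (s * v t)) t := fun t => by
    have := ((hu t).const_mul s).arctan
    simpa [mul_pow] using this
  have hpi : ∀ x, |arctan x| ≤ π / 2 := fun x =>
    abs_le.2 ⟨(neg_pi_div_two_lt_arctan x).le, (arctan_lt_pi_div_two x).le⟩
  have hparts := intervalIntegral.integral_mul_deriv_eq_deriv_mul (a := 0) (b := L)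
    (fun t _ => hv t) (fun t _ => harc t) (hw.intervalIntegrable _ _)
    ((hqc.mul (continuous_const.mul hvc)).intervalIntegrable _ _)
  have h0 : (0:ℝ) ∈ Set.Icc 0 L := ⟨le_rfl, hL⟩
  have h1 : L ∈ Set.Icc 0 L := ⟨hL, le_rfl⟩
  have hbd : ∀ t ∈ Set.Icc 0 L, |v t * arctan (s * u t)| ≤ K * (π / 2) := fun t ht => by
    rw [abs_mul]
    exact mul_le_mul (hK t ht) (hpi _) (abs_nonneg _) hK0
  have hint : |∫ t in (0:ℝ)..L, w t * arctan (s * u t)| ≤ M * (π / 2) * |L - 0| := by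
    rw [← Real.norm_eq_abs]
    refine intervalIntegral.norm_integral_le_of_norm_le_const fun t ht => ?_
    rw [Set.uIoc_of_le hL] at ht
    have ht' : t ∈ Set.Icc 0 L := ⟨ht.1.le, ht.2⟩
    rw [Real.norm_eq_abs, abs_mul]
    exact mul_le_mul (hM t ht') (hpi _) (abs_nonneg _) ((abs_nonneg _).trans (hM t ht'))
  rw [sub_zero, abs_of_nonneg hL] at hint
  have hvv : ∫ t in (0:ℝ)..L, v t ^ 2 * (1 + s ^ 2 * u t ^ 2)⁻¹ ≤ π * (K + L * M) / s := by
    rw [le_div_iff₀ hs0, ← intervalIntegral.integral_mul_const]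
    calc ∫ t in (0:ℝ)..L, v t ^ 2 * (1 + s ^ 2 * u t ^ 2)⁻¹ * s
        = ∫ t in (0:ℝ)..L, v t * ((1 + s ^ 2 * u t ^ 2)⁻¹ * (s * v t)) := by
          congr 1; ext t; ring
      _ ≤ K * (π / 2) + K * (π / 2) + M * (π / 2) * L := by
          rw [hparts]
          have a1 := abs_le.1 (hbd _ h1)
          have a0 := abs_le.1 (hbd _ h0)
          have a2 := abs_le.1 hint
          linarith [a1.2, a0.1, a2.1]
      _ ≤ _ := by
          have : 0 ≤ M * π * L :=
            mul_nonneg (mul_nonneg ((abs_nonneg _).trans (hM 0 h0)) pi_pos.le) hL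
          nlinarith
  calc ∫ t in (0:ℝ)..L, (1 + s ^ 2 * u t ^ 2)⁻¹
      ≤ ∫ t in (0:ℝ)..L, (s⁻¹ + B * (v t ^ 2 * (1 + s ^ 2 * u t ^ 2)⁻¹)) := by
        refine intervalIntegral.integral_mono_on hL (hqc.intervalIntegrable _ _)
          (Continuous.intervalIntegrable (by fun_prop) _ _) fun t ht => ?_
        have h2 : u t ^ 2 * (1 + s ^ 2 * u t ^ 2)⁻¹ ≤ s⁻¹ := by
          rw [← div_eq_mul_inv, div_le_iff₀ (hq t), mul_add, mul_one, ← mul_assoc, pow_two s,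
            inv_mul_cancel_left₀ hs0.ne']
          have : 0 < s⁻¹ := by positivity
          nlinarith [sq_nonneg (u t)]
        have h3 := mul_le_mul_of_nonneg_right (huv t ht) (inv_pos.2 (hq t)).le
        linarith
    _ = L * s⁻¹ + B * ∫ t in (0:ℝ)..L, v t ^ 2 * (1 + s ^ 2 * u t ^ 2)⁻¹ := by
        rw [intervalIntegral.integral_add (by simp)
          (Continuous.intervalIntegrable (by fun_prop) _ _), intervalIntegral.integral_const_mul]
        simp
    _ ≤ L * s⁻¹ + B * (π * (K + L * M) / s) := by gcongr
    _ = _ := by ring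

lemma norm_integral_exp_le {p u v w : ℝ → ℝ} {L B K M s : ℝ} (hL : 0 ≤ L) (hB : 0 ≤ B)
    (hp : ∀ t, HasDerivAt p (u t) t)
    (hu : ∀ t, HasDerivAt u (v t) t) (hv : ∀ t, HasDerivAt v (w t) t) (hw : Continuous w)
    (hK : ∀ t ∈ Set.Icc 0 L, |v t| ≤ K) (hM : ∀ t ∈ Set.Icc 0 L, |w t| ≤ M)
    (huv : ∀ t ∈ Set.Icc 0 L, 1 ≤ u t ^ 2 + B * v t ^ 2) (hs : 1 ≤ s) :
    ‖∫ t in (0:ℝ)..L, Complex.exp (Complex.I * ((s ^ 2 * p t : ℝ) : ℂ))‖ ≤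
      (2 + (K + 1) * (L + B * (π * (K + L * M)))) / s := by
  have hJ := integral_inv_one_add_sq_mul_sq_le hL hB hu hv hw hK hM huv hs
  have hs0 : 0 < s := by linarith
  have hpc : Continuous p := continuous_iff_continuousAt.2 fun t => (hp t).continuousAt
  have huc : Continuous u := continuous_iff_continuousAt.2 fun t => (hu t).continuousAt
  have hvc : Continuous v := continuous_iff_continuousAt.2 fun t => (hv t).continuousAt
  have hq : ∀ t, 0 < 1 + s ^ 2 * u t ^ 2 := fun t => by positivity
  have hqc : Continuous fun t => (1 + s ^ 2 * u t ^ 2)⁻¹ :=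
    Continuous.inv₀ (by fun_prop) fun t => (hq t).ne'
  have hK0 : 0 ≤ K := (abs_nonneg _).trans (hK 0 ⟨le_rfl, hL⟩)
  set E : ℝ → ℂ := fun t => Complex.exp (Complex.I * ((s ^ 2 * p t : ℝ) : ℂ)) with hE
  have hEc : Continuous E := by
    simp only [hE]
    fun_prop
  have hEn : ∀ t, ‖E t‖ = 1 := fun t => by
    simp only [hE]
    rw [mul_comm, Complex.norm_exp_ofReal_mul_I]
  have hEd : ∀ t, HasDerivAt E (E t * (Complex.I * ((s ^ 2 * u t : ℝ) : ℂ))) t := fun t =>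
    ((((hp t).const_mul (s ^ 2)).ofReal_comp).const_mul Complex.I).cexp
  set g : ℝ → ℝ := fun t => u t * (1 + s ^ 2 * u t ^ 2)⁻¹ with hg
  set g' : ℝ → ℝ := fun t => v t * (1 - s ^ 2 * u t ^ 2) * ((1 + s ^ 2 * u t ^ 2)⁻¹) ^ 2 with hg'
  have hgd : ∀ t, HasDerivAt g (g' t) t := fun t => by
    have h1 : HasDerivAt (fun t => 1 + s ^ 2 * u t ^ 2) (s ^ 2 * (2 * u t * v t)) t := by
      have := (((hu t).fun_pow 2).const_mul (s ^ 2)).const_add 1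
      simpa using this
    have h2 := (hu t).mul (h1.fun_inv (hq t).ne')
    refine h2.congr_deriv ?_
    simp only [hg']
    have := (hq t).ne'
    field_simp
    ring
  have hgc' : Continuous g' := by simp only [hg']; fun_prop
  have hg'b : ∀ t ∈ Set.Icc 0 L, |g' t| ≤ K * (1 + s ^ 2 * u t ^ 2)⁻¹ := fun t ht => by
    simp only [hg']
    rw [abs_mul, abs_mul, mul_assoc]
    refine mul_le_mul (hK t ht) ?_ (by positivity) hK0
    rw [pow_two (_⁻¹), abs_mul, abs_of_pos (inv_pos.2 (hq t)), ← mul_assoc]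
    refine mul_le_of_le_one_left (inv_pos.2 (hq t)).le ?_
    rw [← div_eq_mul_inv, div_le_one (hq t), abs_le]
    have : 0 ≤ s ^ 2 * u t ^ 2 := by positivity
    constructor <;> linarith
  have hgb : ∀ t, |g t| ≤ 1 / s := fun t => by
    simp only [hg]
    rw [abs_mul, abs_of_pos (inv_pos.2 (hq t)), ← div_eq_mul_inv, div_le_div_iff₀ (hq t) hs0]
    nlinarith [sq_nonneg (|u t| * s - 1), sq_abs (u t)]
  have hparts := intervalIntegral.integral_mul_deriv_eq_deriv_mul (a := 0) (b := L)
    (fun t _ => (hgd t).ofReal_comp) (fun t _ => hEd t)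
    ((Complex.continuous_ofReal.comp hgc').intervalIntegrable _ _)
    (Continuous.intervalIntegrable (by fun_prop) _ _)
  have hdec : Complex.I * ∫ t in (0:ℝ)..L, E t =
      (∫ t in (0:ℝ)..L, (g t : ℂ) * (E t * (Complex.I * ((s ^ 2 * u t : ℝ) : ℂ)))) +
        Complex.I * ∫ t in (0:ℝ)..L, E t * (((1 + s ^ 2 * u t ^ 2)⁻¹ : ℝ) : ℂ) := by
    rw [← intervalIntegral.integral_const_mul, ← intervalIntegral.integral_const_mul,
      ← intervalIntegral.integral_add]
    · congr 1
      ext t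
      have h1 : u t * (1 + s ^ 2 * u t ^ 2)⁻¹ * (s ^ 2 * u t) + (1 + s ^ 2 * u t ^ 2)⁻¹ = 1 := by
        have := (hq t).ne'
        field_simp
        ring
      have h2 : (g t : ℂ) * ((s ^ 2 * u t : ℝ) : ℂ) + (((1 + s ^ 2 * u t ^ 2)⁻¹ : ℝ) : ℂ) = 1 := by
        simp only [hg]
        rw [← Complex.ofReal_mul, ← Complex.ofReal_add, h1, Complex.ofReal_one]
      linear_combination (-Complex.I * E t) * h2
    · have : Continuous g := by simp only [hg]; fun_prop
      exact Continuous.intervalIntegrable (by fun_prop) _ _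
    · exact Continuous.intervalIntegrable (by fun_prop) _ _
  have hb1 : ‖∫ t in (0:ℝ)..L, (g' t : ℂ) * E t‖ ≤
      K * ∫ t in (0:ℝ)..L, (1 + s ^ 2 * u t ^ 2)⁻¹ := by
    rw [← intervalIntegral.integral_const_mul]
    refine intervalIntegral.norm_integral_le_of_norm_le hL (Filter.Eventually.of_forall
      fun t ht => ?_) (Continuous.intervalIntegrable (by fun_prop) _ _)
    rw [norm_mul, hEn, mul_one, Complex.norm_real]
    exact hg'b t ⟨ht.1.le, ht.2⟩
  have hb2 : ‖∫ t in (0:ℝ)..L, E t * (((1 + s ^ 2 * u t ^ 2)⁻¹ : ℝ) : ℂ)‖ ≤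
      ∫ t in (0:ℝ)..L, (1 + s ^ 2 * u t ^ 2)⁻¹ := by
    refine intervalIntegral.norm_integral_le_of_norm_le hL (Filter.Eventually.of_forall
      fun t ht => ?_) (Continuous.intervalIntegrable (by fun_prop) _ _)
    rw [norm_mul, hEn, one_mul, Complex.norm_real, Real.norm_eq_abs, abs_of_pos (inv_pos.2 (hq t))]
  have hge : ∀ t, ‖(g t : ℂ) * E t‖ ≤ 1 / s := fun t => by
    rw [norm_mul, hEn, mul_one, Complex.norm_real]
    exact hgb t
  calc ‖∫ t in (0:ℝ)..L, E t‖ = ‖Complex.I * ∫ t in (0:ℝ)..L, E t‖ := by simp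
    _ ≤ (1 / s + 1 / s + K * ∫ t in (0:ℝ)..L, (1 + s ^ 2 * u t ^ 2)⁻¹) +
        ∫ t in (0:ℝ)..L, (1 + s ^ 2 * u t ^ 2)⁻¹ := by
        rw [hdec, hparts]
        refine (norm_add_le _ _).trans (add_le_add ((norm_sub_le _ _).trans (add_le_add
          ((norm_sub_le _ _).trans (add_le_add (hge _) (hge _))) hb1)) ?_)
        rwa [norm_mul, Complex.norm_I, one_mul]
    _ = 2 / s + (K + 1) * ∫ t in (0:ℝ)..L, (1 + s ^ 2 * u t ^ 2)⁻¹ := by ring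
    _ ≤ 2 / s + (K + 1) * ((L + B * (π * (K + L * M))) / s) := by gcongr
    _ = _ := by ring

lemma norm_integral_exp_lt {p u v : ℝ → ℝ} {L B r : ℝ} (hL : 0 < L) (hr : 0 < r)
    (hp : ∀ t, HasDerivAt p (u t) t) (hu : ∀ t, HasDerivAt u (v t) t)
    (huv : ∀ t ∈ Set.Icc 0 L, 1 ≤ u t ^ 2 + B * v t ^ 2) :
    ‖∫ t in (0:ℝ)..L, Complex.exp (Complex.I * ((r * p t : ℝ) : ℂ))‖ < L := by
  have hpc : Continuous p := continuous_iff_continuousAt.2 fun t => (hp t).continuousAt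
  set E : ℝ → ℂ := fun t => Complex.exp (Complex.I * ((r * p t : ℝ) : ℂ)) with hE
  have hEc : Continuous E := by
    simp only [hE]
    fun_prop
  have hEn : ∀ t, ‖E t‖ = 1 := fun t => by
    simp only [hE]
    rw [mul_comm, Complex.norm_exp_ofReal_mul_I]
  have hEd : ∀ t, HasDerivAt E (E t * (Complex.I * ((r * u t : ℝ) : ℂ))) t := fun t =>
    ((((hp t).const_mul r).ofReal_comp).const_mul Complex.I).cexp
  rw [intervalIntegral.integral_of_le hL.le, integral_Ioc_eq_integral_Ioo]
  rcases ae_eq_const_or_norm_setIntegral_lt_of_norm_le_const (μ := volume) (t := Set.Ioo 0 L)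
    (f := E) (C := 1) (by simp) (Filter.Eventually.of_forall fun t => (hEn t).le) with h | h
  · exfalso
    have heq : Set.EqOn E (fun _ => ⨍ x in Set.Ioo 0 L, E x) (Set.Ioo 0 L) :=
      Measure.eqOn_open_of_ae_eq h isOpen_Ioo hEc.continuousOn continuousOn_const
    have hu0 : ∀ t ∈ Set.Ioo 0 L, u t = 0 := fun t ht => by
      have h1 : HasDerivAt E 0 t := (hasDerivAt_const t _).congr_of_eventuallyEq
        (Filter.eventuallyEq_of_mem (isOpen_Ioo.mem_nhds ht) heq)
      have h2 := (hEd t).unique h1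
      have h3 : E t ≠ 0 := fun h => by simpa [h] using hEn t
      simpa [h3, hr.ne'] using h2
    have hm : L / 2 ∈ Set.Ioo 0 L := ⟨by linarith, by linarith⟩
    have hv0 : v (L / 2) = 0 := (hu _).unique ((hasDerivAt_const _ (0:ℝ)).congr_of_eventuallyEq
        (Filter.eventuallyEq_of_mem (isOpen_Ioo.mem_nhds hm) hu0))
    have := huv _ ⟨hm.1.le, hm.2.le⟩
    rw [hu0 _ hm, hv0] at this
    norm_num at this
  · simpa [hL.le, hE] using h

lemma dual_curvature_bound {γ : ℝ → ℝ × ℝ} {L Kmin : ℝ} (hL : 0 < L) (hKmin : 0 < Kmin)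
    (hsmooth : ContDiff ℝ (⊤ : ℕ∞) γ)
    (hunit : ∀ t ∈ Set.Icc (0:ℝ) L, e2 (deriv γ t) = 1)
    (hcurv : ∀ t ∈ Set.Icc (0:ℝ) L, Kmin ≤ e2 (deriv (deriv γ) t))
    {c s : ℝ} (hcs : c ^ 2 + s ^ 2 = 1) {t : ℝ} (ht : t ∈ Set.Icc (0:ℝ) L) :
    1 ≤ (c * (deriv γ t).1 + s * (deriv γ t).2) ^ 2 +
      (Kmin ^ 2)⁻¹ * (c * (deriv (deriv γ) t).1 + s * (deriv (deriv γ) t).2) ^ 2 := by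
  have hd : ContDiff ℝ (⊤ : ℕ∞) (deriv γ) := hsmooth.deriv'
  have hunit' : ∀ τ ∈ Set.Icc (0:ℝ) L, (deriv γ τ).1 ^ 2 + (deriv γ τ).2 ^ 2 = 1 := fun τ hτ => by
    have := hunit τ hτ
    rwa [e2, Real.sqrt_eq_one] at this
  have hdd : HasDerivAt (deriv γ) (deriv (deriv γ) t) t :=
    (hd.differentiable (by simp)).differentiableAt.hasDerivAt
  have hd₁ : HasDerivAt (fun τ => (deriv γ τ).1) (deriv (deriv γ) t).1 t :=
    (hasFDerivAt_fst (𝕜 := ℝ) (E := ℝ) (F := ℝ)).comp_hasDerivAt t hdd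
  have hd₂ : HasDerivAt (fun τ => (deriv γ τ).2) (deriv (deriv γ) t).2 t :=
    (hasFDerivAt_snd (𝕜 := ℝ) (E := ℝ) (F := ℝ)).comp_hasDerivAt t hdd
  have horth : 2 * (deriv γ t).1 * (deriv (deriv γ) t).1 +
      2 * (deriv γ t).2 * (deriv (deriv γ) t).2 = 0 := by
    have h1 : HasDerivAt (fun τ => (deriv γ τ).1 ^ 2 + (deriv γ τ).2 ^ 2)
        (2 * (deriv γ t).1 * (deriv (deriv γ) t).1 +
          2 * (deriv γ t).2 * (deriv (deriv γ) t).2) t := by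
      simpa using (hd₁.fun_pow 2).fun_add (hd₂.fun_pow 2)
    have h2 : HasDerivWithinAt (fun τ => (deriv γ τ).1 ^ 2 + (deriv γ τ).2 ^ 2) 0
        (Set.Icc 0 L) t :=
      (hasDerivWithinAt_const t _ (1:ℝ)).congr hunit' (hunit' t ht)
    exact (uniqueDiffOn_Icc hL t ht).eq_deriv _ h1.hasDerivWithinAt h2
  have hx := hunit' t ht
  have hk : Kmin ^ 2 ≤ (deriv (deriv γ) t).1 ^ 2 + (deriv (deriv γ) t).2 ^ 2 :=
    (Real.le_sqrt hKmin.le (by positivity)).1 (hcurv t ht)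
  generalize (deriv γ t).1 = a at *
  generalize (deriv γ t).2 = b at *
  generalize (deriv (deriv γ) t).1 = a' at *
  generalize (deriv (deriv γ) t).2 = b' at *
  have e : (c * a' + s * b') ^ 2 = (a' ^ 2 + b' ^ 2) * (s * a - c * b) ^ 2 := by
    have ea : a' = -b * (a * b' - b * a') := by linear_combination (-a') * hx + a / 2 * horth
    have eb : b' = a * (a * b' - b * a') := by linear_combination (-b') * hx + b / 2 * horth
    generalize a * b' - b * a' = k at ea eb
    subst ea eb
    linear_combination (-k ^ 2 * (s * a - c * b) ^ 2) * hx
  have f : (c * a + s * b) ^ 2 + (s * a - c * b) ^ 2 = 1 := by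
    linear_combination (a ^ 2 + b ^ 2) * hcs + hx
  rw [e, ← f]
  gcongr
  rw [← mul_assoc]
  refine le_mul_of_one_le_left (sq_nonneg _) ?_
  rwa [← div_eq_inv_mul, one_le_div (by positivity)]

lemma exists_norm_integral_exp_curve_le {γ : ℝ → ℝ × ℝ} {L Kmin : ℝ} (hL : 0 < L)
    (hKmin : 0 < Kmin) (hsmooth : ContDiff ℝ (⊤ : ℕ∞) γ)
    (hunit : ∀ t ∈ Set.Icc (0:ℝ) L, e2 (deriv γ t) = 1)
    (hcurv : ∀ t ∈ Set.Icc (0:ℝ) L, Kmin ≤ e2 (deriv (deriv γ) t)) :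
    ∃ C > (0:ℝ), ∀ ξ : ℤ × ℤ, ξ ≠ 0 →
      ‖∫ t in (0:ℝ)..L, Complex.exp
        (Complex.I * Complex.ofReal ((ξ.1 : ℝ) * (γ t).1 + (ξ.2 : ℝ) * (γ t).2))‖ < L ∧
      ‖∫ t in (0:ℝ)..L, Complex.exp
        (Complex.I * Complex.ofReal ((ξ.1 : ℝ) * (γ t).1 + (ξ.2 : ℝ) * (γ t).2))‖
        ≤ C / √(e2 (iv ξ)) := by
  have hd1 : ContDiff ℝ (⊤ : ℕ∞) (deriv γ) := hsmooth.deriv'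
  have hd2 : ContDiff ℝ (⊤ : ℕ∞) (deriv (deriv γ)) := hd1.deriv'
  have hd3 : ContDiff ℝ (⊤ : ℕ∞) (deriv (deriv (deriv γ))) := hd2.deriv'
  have hbound : ∀ f : ℝ → ℝ × ℝ, Continuous f → ∃ K : ℝ, ∀ c s : ℝ, c ^ 2 + s ^ 2 = 1 →
      ∀ t ∈ Set.Icc (0:ℝ) L, |c * (f t).1 + s * (f t).2| ≤ K := by
    intro f hf
    obtain ⟨K, hK⟩ := isCompact_Icc.exists_bound_of_continuousOn (s := Set.Icc (0:ℝ) L)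
      hf.continuousOn
    refine ⟨K + K, fun c s hcs t ht => ?_⟩
    have hc : |c| ≤ 1 := abs_le_one_iff_mul_self_le_one.2 (by nlinarith [sq_nonneg s])
    have hs : |s| ≤ 1 := abs_le_one_iff_mul_self_le_one.2 (by nlinarith [sq_nonneg c])
    have h1 : |(f t).1| ≤ K := (norm_fst_le (f t)).trans (hK t ht)
    have h2 : |(f t).2| ≤ K := (norm_snd_le (f t)).trans (hK t ht)
    refine (abs_add_le _ _).trans (add_le_add ?_ ?_)
    · rw [abs_mul]
      exact (mul_le_of_le_one_left (abs_nonneg _) hc).trans h1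
    · rw [abs_mul]
      exact (mul_le_of_le_one_left (abs_nonneg _) hs).trans h2
  obtain ⟨K, hK⟩ := hbound _ hd2.continuous
  obtain ⟨M, hM⟩ := hbound _ hd3.continuous
  refine ⟨max 1 (2 + (K + 1) * (L + (Kmin ^ 2)⁻¹ * (π * (K + L * M)))),
    lt_max_of_lt_left one_pos, fun ξ hξ => ?_⟩
  set r := e2 (iv ξ) with hr
  have hr2 : r ^ 2 = (ξ.1 : ℝ) ^ 2 + (ξ.2 : ℝ) ^ 2 := Real.sq_sqrt (by positivity)
  have hr1 : 1 ≤ r := by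
    rw [hr, e2, Real.one_le_sqrt]
    have : 1 ≤ ξ.1 ^ 2 + ξ.2 ^ 2 := by
      by_contra! h
      apply hξ
      have h1 : ξ.1 = 0 := by nlinarith [sq_nonneg ξ.1, sq_nonneg ξ.2]
      have h2 : ξ.2 = 0 := by nlinarith [sq_nonneg ξ.1, sq_nonneg ξ.2]
      exact Prod.ext h1 h2
    simp only [iv]
    exact_mod_cast this
  have hr0 : 0 < r := by linarith
  have hcs : ((ξ.1 : ℝ) / r) ^ 2 + ((ξ.2 : ℝ) / r) ^ 2 = 1 := by
    field_simp
    exact hr2.symm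
  have hder : ∀ f : ℝ → ℝ × ℝ, ContDiff ℝ (⊤ : ℕ∞) f → ∀ t, HasDerivAt
      (fun t => (ξ.1 : ℝ) / r * (f t).1 + (ξ.2 : ℝ) / r * (f t).2)
      ((ξ.1 : ℝ) / r * (deriv f t).1 + (ξ.2 : ℝ) / r * (deriv f t).2) t := by
    intro f hf t
    have h : HasDerivAt f (deriv f t) t :=
      (hf.differentiable (by simp)).differentiableAt.hasDerivAt
    have h₁ : HasDerivAt (fun t => (f t).1) (deriv f t).1 t :=
      (hasFDerivAt_fst (𝕜 := ℝ) (E := ℝ) (F := ℝ)).comp_hasDerivAt t h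
    have h₂ : HasDerivAt (fun t => (f t).2) (deriv f t).2 t :=
      (hasFDerivAt_snd (𝕜 := ℝ) (E := ℝ) (F := ℝ)).comp_hasDerivAt t h
    exact (h₁.const_mul _).fun_add (h₂.const_mul _)
  have hphase : ∀ t, (ξ.1 : ℝ) * (γ t).1 + (ξ.2 : ℝ) * (γ t).2 =
      r * ((ξ.1 : ℝ) / r * (γ t).1 + (ξ.2 : ℝ) / r * (γ t).2) := fun t => by
    field_simp
  have huv := fun t ht => dual_curvature_bound (t := t) hL hKmin hsmooth hunit hcurv hcs ht
  simp only [hphase]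
  refine ⟨norm_integral_exp_lt hL hr0 (hder _ hsmooth) (hder _ hd1) huv, ?_⟩
  have hw : Continuous fun t => (ξ.1 : ℝ) / r * (deriv (deriv (deriv γ)) t).1 +
      (ξ.2 : ℝ) / r * (deriv (deriv (deriv γ)) t).2 := by
    have := hd3.continuous
    fun_prop
  have h := norm_integral_exp_le (s := √r) hL.le (by positivity) (hder _ hsmooth) (hder _ hd1)
    (hder _ hd2) hw (hK _ _ hcs) (hM _ _ hcs) huv (Real.one_le_sqrt.2 hr1)
  rw [Real.sq_sqrt hr0.le] at h
  refine h.trans ?_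
  gcongr
  exact le_max_right _ _

lemma finite_setOf_e2_iv_lt (R : ℝ) : {ξ : ℤ × ℤ | e2 (iv ξ) < R}.Finite := by
  refine (Set.finite_Icc ((-⌈R⌉ : ℤ), (-⌈R⌉ : ℤ)) (⌈R⌉, ⌈R⌉)).subset fun ξ hξ => ?_
  have h : e2 (iv ξ) < ⌈R⌉ := lt_of_lt_of_le hξ (Int.le_ceil R)
  have h1 : |(ξ.1 : ℝ)| < ⌈R⌉ :=
    (Real.abs_le_sqrt (by simp only [iv]; nlinarith [sq_nonneg (ξ.2 : ℝ)])).trans_lt h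
  have h2 : |(ξ.2 : ℝ)| < ⌈R⌉ :=
    (Real.abs_le_sqrt (by simp only [iv]; nlinarith [sq_nonneg (ξ.1 : ℝ)])).trans_lt h
  have h1' : |ξ.1| < ⌈R⌉ := by exact_mod_cast h1
  have h2' : |ξ.2| < ⌈R⌉ := by exact_mod_cast h2
  rw [abs_lt] at h1' h2'
  exact ⟨⟨h1'.1.le, h2'.1.le⟩, h1'.2.le, h2'.2.le⟩

lemma exists_uniform_norm_integral_exp_curve_le {γ : ℝ → ℝ × ℝ} {L Kmin : ℝ} (hL : 0 < L)
    (hKmin : 0 < Kmin) (hsmooth : ContDiff ℝ (⊤ : ℕ∞) γ)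
    (hunit : ∀ t ∈ Set.Icc (0:ℝ) L, e2 (deriv γ t) = 1)
    (hcurv : ∀ t ∈ Set.Icc (0:ℝ) L, Kmin ≤ e2 (deriv (deriv γ) t)) :
    ∃ C > (0:ℝ), ∃ m < L, 0 ≤ m ∧ ∀ ξ : ℤ × ℤ, ξ ≠ 0 →
      ‖∫ t in (0:ℝ)..L, Complex.exp
        (Complex.I * Complex.ofReal ((ξ.1 : ℝ) * (γ t).1 + (ξ.2 : ℝ) * (γ t).2))‖ ≤ m ∧
      ‖∫ t in (0:ℝ)..L, Complex.exp
        (Complex.I * Complex.ofReal ((ξ.1 : ℝ) * (γ t).1 + (ξ.2 : ℝ) * (γ t).2))‖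
        ≤ C / √(e2 (iv ξ)) := by
  obtain ⟨C, hC, h⟩ := exists_norm_integral_exp_curve_le hL hKmin hsmooth hunit hcurv
  set k : ℤ × ℤ → ℝ := fun ξ => ‖∫ t in (0:ℝ)..L, Complex.exp
        (Complex.I * Complex.ofReal ((ξ.1 : ℝ) * (γ t).1 + (ξ.2 : ℝ) * (γ t).2))‖ with hk
  have hfar : ∀ ξ, ξ ≠ 0 → (2 * C / L) ^ 2 ≤ e2 (iv ξ) → k ξ ≤ L / 2 := fun ξ hξ hR => by
    refine (h ξ hξ).2.trans ?_
    have h1 : 2 * C / L ≤ √(e2 (iv ξ)) := Real.le_sqrt_of_sq_le hR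
    have h2 : 0 < 2 * C / L := by positivity
    rw [div_le_iff₀ (h2.trans_le h1)]
    rw [div_le_iff₀ hL] at h1
    linarith
  have hfin : ({ξ : ℤ × ℤ | e2 (iv ξ) < (2 * C / L) ^ 2} \ {0}).Finite :=
    (finite_setOf_e2_iv_lt _).sdiff
  obtain ⟨m, hm, hm'⟩ : ∃ m < L, ∀ ξ ∈ {ξ : ℤ × ℤ | e2 (iv ξ) < (2 * C / L) ^ 2} \ {0},
      k ξ ≤ m := by
    rcases Set.eq_empty_or_nonempty
      ({ξ : ℤ × ℤ | e2 (iv ξ) < (2 * C / L) ^ 2} \ {0}) with he | hne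
    · exact ⟨0, hL, by simp [he]⟩
    · obtain ⟨ξ₀, hξ₀, hmax⟩ := Set.exists_max_image _ k hfin hne
      exact ⟨k ξ₀, (h ξ₀ hξ₀.2).1, hmax⟩
  refine ⟨C, hC, max m (L / 2), max_lt hm (by linarith), le_max_of_le_right (by linarith),
    fun ξ hξ => ⟨?_, (h ξ hξ).2⟩⟩
  rcases lt_or_ge (e2 (iv ξ)) ((2 * C / L) ^ 2) with hlt | hge
  · exact le_max_of_le_left (hm' ξ ⟨hlt, hξ⟩)
  · exact le_max_of_le_right (hfar ξ hξ hge)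

lemma sq_add_sq_eq_of_mem_Elat {lam : ℝ} {μ : ℤ × ℤ} (h : μ ∈ Elat lam) :
    (μ.1 : ℝ) ^ 2 + (μ.2 : ℝ) ^ 2 = lam ^ 2 := by
  classical
  exact (Finset.mem_filter.1 h).2

lemma exists_card_Elat_le_rpow {ε : ℝ} (hε : 0 < ε) :
    ∃ C : ℝ, 0 < C ∧ ∀ lam : ℝ, 0 < lam → ((Elat lam).card : ℝ) ≤ C * lam ^ ε := by
  obtain ⟨C, hC, h⟩ := exists_ncard_gaussianInt_norm_eq_le_rpow (half_pos hε)
  refine ⟨C, hC, fun lam hlam => ?_⟩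
  rcases (Elat lam).eq_empty_or_nonempty with he | ⟨μ, hμ⟩
  · rw [he]
    simp only [Finset.card_empty, Nat.cast_zero]
    positivity
  obtain ⟨n, hn⟩ : ∃ n : ℕ, (n : ℝ) = lam ^ 2 :=
    ⟨(μ.1 ^ 2 + μ.2 ^ 2).toNat, by
      rw [← sq_add_sq_eq_of_mem_Elat hμ]
      have : (((μ.1 ^ 2 + μ.2 ^ 2).toNat : ℤ) : ℝ) = ((μ.1 ^ 2 + μ.2 ^ 2 : ℤ) : ℝ) := by
        rw [Int.toNat_of_nonneg (by positivity)]
      push_cast at this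
      exact_mod_cast this⟩
  have hn0 : 0 < n := by
    have : (0:ℝ) < n := by rw [hn]; positivity
    exact_mod_cast this
  have hcard : (Elat lam).card ≤ {z : GaussianInt | z.norm = n}.ncard := by
    rw [← Set.ncard_coe_finset]
    refine Set.ncard_le_ncard_of_injOn (fun ν : ℤ × ℤ => (⟨ν.1, ν.2⟩ : GaussianInt)) ?_ ?_
      (finite_gaussianInt_norm_eq n)
    · intro ν hν
      have := sq_add_sq_eq_of_mem_Elat hν
      rw [← hn] at this
      have h2 : ν.1 ^ 2 + ν.2 ^ 2 = (n : ℤ) := by exact_mod_cast this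
      simp only [Set.mem_ofPred_eq, Zsqrtd.norm_def]
      linarith
    · intro ν _ ν' _ hνν'
      exact Prod.ext (congrArg Zsqrtd.re hνν') (congrArg Zsqrtd.im hνν')
  calc ((Elat lam).card : ℝ) ≤ {z : GaussianInt | z.norm = n}.ncard := by exact_mod_cast hcard
    _ ≤ C * (n : ℝ) ^ (ε / 2) := h n hn0
    _ = C * lam ^ ε := by
        rw [hn, ← Real.rpow_natCast, ← Real.rpow_mul hlam.le]
        congr 2
        push_cast
        ring

/-- The squared Euclidean distance between two lattice points. -/
def sqDist (μ ν : ℤ × ℤ) : ℝ := ((μ.1 : ℝ) - ν.1) ^ 2 + ((μ.2 : ℝ) - ν.2) ^ 2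

lemma sqDist_comm (μ ν : ℤ × ℤ) : sqDist μ ν = sqDist ν μ := by
  simp only [sqDist]
  ring

lemma sqDist_pos {μ ν : ℤ × ℤ} (h : μ ≠ ν) : 0 < sqDist μ ν := by
  have h0 : 0 ≤ sqDist μ ν := by unfold sqDist; positivity
  refine h0.lt_of_ne fun h' => h ?_
  simp only [sqDist] at h'
  have h1 : (μ.1 : ℝ) - ν.1 = 0 := by
    nlinarith [sq_nonneg ((μ.1 : ℝ) - ν.1), sq_nonneg ((μ.2 : ℝ) - ν.2)]
  have h2 : (μ.2 : ℝ) - ν.2 = 0 := by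
    nlinarith [sq_nonneg ((μ.1 : ℝ) - ν.1), sq_nonneg ((μ.2 : ℝ) - ν.2)]
  exact Prod.ext (by exact_mod_cast sub_eq_zero.1 h1) (by exact_mod_cast sub_eq_zero.1 h2)

lemma four_mul_sq_le_prod_sqDist {lam : ℝ} {μ ν ρ : ℤ × ℤ} (hμ : μ ∈ Elat lam)
    (hν : ν ∈ Elat lam) (hρ : ρ ∈ Elat lam) (h1 : μ ≠ ν) (h2 : μ ≠ ρ) (h3 : ν ≠ ρ) :
    4 * lam ^ 2 ≤ sqDist μ ν * sqDist μ ρ * sqDist ν ρ := by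
  have p := mul_pos (mul_pos (sqDist_pos h1) (sqDist_pos h2)) (sqDist_pos h3)
  have eμ := sq_add_sq_eq_of_mem_Elat hμ
  have eν := sq_add_sq_eq_of_mem_Elat hν
  have eρ := sq_add_sq_eq_of_mem_Elat hρ
  set D : ℤ := (ν.1 - μ.1) * (ρ.2 - μ.2) - (ν.2 - μ.2) * (ρ.1 - μ.1) with hD
  have key : sqDist μ ν * sqDist μ ρ * sqDist ν ρ = 4 * lam ^ 2 * (D : ℝ) ^ 2 := by
    rw [hD]
    push_cast
    simp only [sqDist]
    generalize (μ.1 : ℝ) = a at *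
    generalize (μ.2 : ℝ) = b at *
    obtain ⟨u, hu⟩ : ∃ u, (ν.1 : ℝ) = a + u := ⟨_, (add_sub_cancel _ _).symm⟩
    obtain ⟨u', hu'⟩ : ∃ u, (ν.2 : ℝ) = b + u := ⟨_, (add_sub_cancel _ _).symm⟩
    obtain ⟨v, hv⟩ : ∃ u, (ρ.1 : ℝ) = a + u := ⟨_, (add_sub_cancel _ _).symm⟩
    obtain ⟨v', hv'⟩ : ∃ u, (ρ.2 : ℝ) = b + u := ⟨_, (add_sub_cancel _ _).symm⟩
    rw [hu, hu'] at eν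
    rw [hv, hv'] at eρ
    rw [hu, hu', hv, hv']
    have e1 : u ^ 2 + u' ^ 2 = -2 * (a * u + b * u') := by linear_combination eν - eμ
    have e2 : v ^ 2 + v' ^ 2 = -2 * (a * v + b * v') := by linear_combination eρ - eμ
    calc ((a - (a + u)) ^ 2 + (b - (b + u')) ^ 2) * ((a - (a + v)) ^ 2 + (b - (b + v')) ^ 2) *
          ((a + u - (a + v)) ^ 2 + (b + u' - (b + v')) ^ 2)
        = ((u ^ 2 + u' ^ 2) * v - (v ^ 2 + v' ^ 2) * u) ^ 2 +
          ((u ^ 2 + u' ^ 2) * v' - (v ^ 2 + v' ^ 2) * u') ^ 2 := by ring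
      _ = 4 * (a ^ 2 + b ^ 2) * (u * v' - u' * v) ^ 2 := by rw [e1, e2]; ring
      _ = _ := by rw [eμ]; ring
  have hD0 : D ≠ 0 := by
    intro h
    rw [key, h] at p
    simp at p
  have hD1 : (1 : ℝ) ≤ (D : ℝ) ^ 2 := by
    have : 1 ≤ D ^ 2 := (one_le_sq_iff_one_le_abs D).2 (Int.one_le_abs hD0)
    exact_mod_cast this
  rw [key]
  nlinarith [sq_nonneg lam]

lemma card_near_le_one {lam T : ℝ} (hT : T ^ 3 ≤ lam ^ 2) {μ : ℤ × ℤ} (hμ : μ ∈ Elat lam) :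
    ((Elat lam).filter fun ν => μ ≠ ν ∧ sqDist μ ν < T).card ≤ 1 := by
  rw [Finset.card_le_one]
  intro ν hν ρ hρ
  rw [Finset.mem_filter] at hν hρ
  by_contra hne
  have h := four_mul_sq_le_prod_sqDist hμ hν.1 hρ.1 hν.2.1 hρ.2.1 hne
  have p1 := sqDist_pos hν.2.1
  have p2 := sqDist_pos hρ.2.1
  have p3 := sqDist_pos hne
  have hT0 : 0 < T := p1.trans hν.2.2
  have h3 : sqDist ν ρ ≤ 4 * T := by
    have : sqDist ν ρ ≤ 2 * sqDist μ ν + 2 * sqDist μ ρ := by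
      simp only [sqDist]
      nlinarith [sq_nonneg ((μ.1 : ℝ) - ν.1 + (μ.1 - ρ.1)),
        sq_nonneg ((μ.2 : ℝ) - ν.2 + (μ.2 - ρ.2))]
    linarith [hν.2.2, hρ.2.2]
  have h4 : sqDist μ ν * sqDist μ ρ < T * T :=
    mul_lt_mul'' hν.2.2 hρ.2.2 p1.le p2.le
  have h5 : sqDist μ ν * sqDist μ ρ * sqDist ν ρ < T * T * (4 * T) :=
    mul_lt_mul h4 h3 p3 (by positivity)
  nlinarith

lemma sum_mul_mul_le_of_row_sum_le {ι : Type*} (s : Finset ι) (b : ι → ℝ) (k : ι → ι → ℝ) {ρ : ℝ}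
    (hk : ∀ i j, 0 ≤ k i j) (hsymm : ∀ i j, k i j = k j i)
    (hrow : ∀ i ∈ s, ∑ j ∈ s, k i j ≤ ρ) :
    ∑ i ∈ s, ∑ j ∈ s, b i * b j * k i j ≤ ρ * ∑ i ∈ s, b i ^ 2 := by
  have h1 : ∑ i ∈ s, ∑ j ∈ s, b i ^ 2 * k i j ≤ ρ * ∑ i ∈ s, b i ^ 2 := by
    rw [Finset.mul_sum]
    refine Finset.sum_le_sum fun i hi => ?_
    rw [← Finset.mul_sum, mul_comm]
    exact mul_le_mul_of_nonneg_right (hrow i hi) (sq_nonneg _)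
  have h2 : ∑ i ∈ s, ∑ j ∈ s, b j ^ 2 * k i j = ∑ i ∈ s, ∑ j ∈ s, b i ^ 2 * k i j := by
    rw [Finset.sum_comm]
    simp only [hsymm]
  calc ∑ i ∈ s, ∑ j ∈ s, b i * b j * k i j
      ≤ ∑ i ∈ s, ∑ j ∈ s, (b i ^ 2 * k i j + b j ^ 2 * k i j) / 2 := by
        refine Finset.sum_le_sum fun i _ => Finset.sum_le_sum fun j _ => ?_
        nlinarith [mul_nonneg (sq_nonneg (b i - b j)) (hk i j)]
    _ = (∑ i ∈ s, ∑ j ∈ s, b i ^ 2 * k i j + ∑ i ∈ s, ∑ j ∈ s, b j ^ 2 * k i j) / 2 := by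
        simp only [← Finset.sum_div, Finset.sum_add_distrib]
    _ ≤ _ := by rw [h2]; linarith

lemma continuous_efn (lam : ℝ) (a : ℤ × ℤ → ℂ) : Continuous (efn lam a) := by
  unfold efn
  fun_prop

lemma norm_sq_efn_eq (lam : ℝ) (a : ℤ × ℤ → ℂ) (x : ℝ × ℝ) :
    ((‖efn lam a x‖ ^ 2 : ℝ) : ℂ) = ∑ μ ∈ Elat lam, ∑ ν ∈ Elat lam,
      a μ * starRingEnd ℂ (a ν) * Complex.exp (Complex.I * Complex.ofReal
        (((μ - ν).1 : ℝ) * x.1 + ((μ - ν).2 : ℝ) * x.2)) := by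
  rw [Complex.ofReal_pow, ← Complex.mul_conj', efn, map_sum, Finset.sum_mul_sum]
  refine Finset.sum_congr rfl fun μ _ => Finset.sum_congr rfl fun ν _ => ?_
  rw [map_mul, ← Complex.exp_conj, map_mul, Complex.conj_I, Complex.conj_ofReal, mul_mul_mul_comm,
    ← Complex.exp_add]
  congr 2
  simp only [Prod.fst_sub, Prod.snd_sub]
  push_cast
  ring

lemma norm_efn_le (lam : ℝ) (a : ℤ × ℤ → ℂ) (x : ℝ × ℝ) :
    ‖efn lam a x‖ ≤ √((Elat lam).card * ∑ μ ∈ Elat lam, ‖a μ‖ ^ 2) := by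
  refine (norm_sum_le _ _).trans (Real.le_sqrt_of_sq_le ?_)
  refine le_trans (le_of_eq ?_) (sq_sum_le_card_mul_sum_sq (s := Elat lam) (f := fun μ => ‖a μ‖))
  congr 1
  refine Finset.sum_congr rfl fun μ _ => ?_
  rw [norm_mul, mul_comm Complex.I, Complex.norm_exp_ofReal_mul_I, mul_one]

lemma integral_exp_int_mul (n : ℤ) :
    ∫ x in Set.Icc (0:ℝ) (2 * π), Complex.exp (Complex.I * ((n : ℝ) * x : ℝ)) =
      if n = 0 then ((2 * π : ℝ) : ℂ) else 0 := by
  have hpi : (0:ℝ) ≤ 2 * π := by positivity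
  rw [integral_Icc_eq_integral_Ioc, ← intervalIntegral.integral_of_le hpi]
  split_ifs with h
  · simp [h]
  · have hc : Complex.I * (n : ℂ) ≠ 0 := by simp [h]
    have e : ∀ x : ℝ, Complex.I * ((n : ℝ) * x : ℝ) = Complex.I * (n : ℂ) * x := fun x => by
      push_cast
      ring
    simp only [e]
    rw [integral_exp_mul_complex hc]
    have : Complex.I * (n : ℂ) * ((2 * π : ℝ) : ℂ) = n * (2 * π * Complex.I) := by
      push_cast
      ring
    rw [this, Complex.exp_int_mul_two_pi_mul_I]
    simp

lemma integral_torus_exp (ξ : ℤ × ℤ) :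
    ∫ x in (Set.Icc (0:ℝ) (2 * π)) ×ˢ (Set.Icc (0:ℝ) (2 * π)), Complex.exp (Complex.I *
      Complex.ofReal ((ξ.1 : ℝ) * x.1 + (ξ.2 : ℝ) * x.2)) =
      if ξ = 0 then (((2 * π) ^ 2 : ℝ) : ℂ) else 0 := by
  have e : ∀ x : ℝ × ℝ, Complex.exp (Complex.I *
      Complex.ofReal ((ξ.1 : ℝ) * x.1 + (ξ.2 : ℝ) * x.2)) =
      Complex.exp (Complex.I * ((ξ.1 : ℝ) * x.1 : ℝ)) *
        Complex.exp (Complex.I * ((ξ.2 : ℝ) * x.2 : ℝ)) := fun x => by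
    rw [← Complex.exp_add, ← mul_add, ← Complex.ofReal_add]
  simp only [e]
  rw [Measure.volume_eq_prod, setIntegral_prod_mul
    (fun x : ℝ => Complex.exp (Complex.I * ((ξ.1 : ℝ) * x : ℝ)))
    (fun x : ℝ => Complex.exp (Complex.I * ((ξ.2 : ℝ) * x : ℝ))), integral_exp_int_mul,
    integral_exp_int_mul]
  by_cases h1 : ξ.1 = 0 <;> by_cases h2 : ξ.2 = 0 <;> simp [h1, h2, Prod.ext_iff, pow_two]

lemma l2T_efn (lam : ℝ) (a : ℤ × ℤ → ℂ) :
    l2T (efn lam a) = 2 * π * √(∑ μ ∈ Elat lam, ‖a μ‖ ^ 2) := by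
  have hint : ∫ x in (Set.Icc (0:ℝ) (2 * π)) ×ˢ (Set.Icc (0:ℝ) (2 * π)), ‖efn lam a x‖ ^ 2 =
      (2 * π) ^ 2 * ∑ μ ∈ Elat lam, ‖a μ‖ ^ 2 := by
    rw [← Complex.ofReal_inj, ← integral_complex_ofReal]
    simp only [norm_sq_efn_eq]
    have hi : ∀ μ ν : ℤ × ℤ, IntegrableOn (fun x : ℝ × ℝ => a μ * starRingEnd ℂ (a ν) *
        Complex.exp (Complex.I * Complex.ofReal
        (((μ - ν).1 : ℝ) * x.1 + ((μ - ν).2 : ℝ) * x.2)))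
        ((Set.Icc (0:ℝ) (2 * π)) ×ˢ (Set.Icc (0:ℝ) (2 * π))) := fun μ ν =>
      Continuous.continuousOn (by fun_prop) |>.integrableOn_compact
        (isCompact_Icc.prod isCompact_Icc)
    rw [integral_finsetSum _ fun μ _ => integrable_finsetSum _ fun ν _ => hi μ ν]
    simp only [integral_finsetSum _ fun ν _ => hi _ ν, integral_const_mul, integral_torus_exp,
      sub_eq_zero]
    rw [Finset.mul_sum, Complex.ofReal_sum]
    refine Finset.sum_congr rfl fun μ hμ => ?_
    simp only [mul_ite, mul_zero, Finset.sum_ite_eq, hμ, if_true]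
    rw [Complex.mul_conj']
    push_cast
    ring
  rw [l2T, hint, Real.sqrt_mul (by positivity), Real.sqrt_sq (by positivity)]

lemma le_integral_norm_sq_efn {γ : ℝ → ℝ × ℝ} (hγ : Continuous γ) {L ρ lam : ℝ}
    (a : ℤ × ℤ → ℂ)
    (hrow : ∀ μ ∈ Elat lam, ∑ ν ∈ Elat lam, (if μ = ν then 0 else
      ‖∫ t in (0:ℝ)..L, Complex.exp (Complex.I *
        Complex.ofReal (((μ - ν).1 : ℝ) * (γ t).1 + ((μ - ν).2 : ℝ) * (γ t).2))‖) ≤ ρ) :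
    (L - ρ) * ∑ μ ∈ Elat lam, ‖a μ‖ ^ 2 ≤ ∫ t in (0:ℝ)..L, ‖efn lam a (γ t)‖ ^ 2 := by
  set K : ℤ × ℤ → ℂ := fun ξ => ∫ t in (0:ℝ)..L, Complex.exp
        (Complex.I * Complex.ofReal ((ξ.1 : ℝ) * (γ t).1 + (ξ.2 : ℝ) * (γ t).2)) with hK
  have hKneg : ∀ ξ, ‖K (-ξ)‖ = ‖K ξ‖ := fun ξ => by
    rw [← Complex.norm_conj (K ξ)]
    simp only [hK]
    rw [← intervalIntegral.intervalIntegral_conj]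
    congr 2
    ext t
    rw [← Complex.exp_conj, map_mul, Complex.conj_I, Complex.conj_ofReal]
    congr 1
    simp only [Prod.fst_neg, Prod.snd_neg]
    push_cast
    ring
  have hexp : ((∫ t in (0:ℝ)..L, ‖efn lam a (γ t)‖ ^ 2 : ℝ) : ℂ) =
      ∑ μ ∈ Elat lam, ∑ ν ∈ Elat lam, a μ * starRingEnd ℂ (a ν) * K (μ - ν) := by
    rw [← intervalIntegral.integral_ofReal]
    simp only [norm_sq_efn_eq]
    have hi : ∀ μ ν : ℤ × ℤ, IntervalIntegrable (fun t : ℝ => a μ * starRingEnd ℂ (a ν) *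
        Complex.exp (Complex.I * Complex.ofReal
        (((μ - ν).1 : ℝ) * (γ t).1 + ((μ - ν).2 : ℝ) * (γ t).2))) volume 0 L := fun μ ν =>
      Continuous.intervalIntegrable (by fun_prop) _ _
    rw [intervalIntegral.integral_finsetSum fun μ _ =>
      Continuous.intervalIntegrable (by fun_prop) _ _]
    simp only [intervalIntegral.integral_finsetSum fun ν _ => hi _ ν,
      intervalIntegral.integral_const_mul, hK]
  have hdiff : ((∫ t in (0:ℝ)..L, ‖efn lam a (γ t)‖ ^ 2 : ℝ) : ℂ) -
      ((L * ∑ μ ∈ Elat lam, ‖a μ‖ ^ 2 : ℝ) : ℂ) = ∑ μ ∈ Elat lam, ∑ ν ∈ Elat lam,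
        a μ * starRingEnd ℂ (a ν) * (if μ = ν then 0 else K (μ - ν)) := by
    have hK0 : K 0 = L := by simp [hK]
    rw [hexp, Finset.mul_sum, Complex.ofReal_sum, ← Finset.sum_sub_distrib]
    refine Finset.sum_congr rfl fun μ hμ => ?_
    rw [sub_eq_iff_eq_add]
    have : ((L * ‖a μ‖ ^ 2 : ℝ) : ℂ) = ∑ ν ∈ Elat lam,
        if μ = ν then a μ * starRingEnd ℂ (a ν) * K (μ - ν) else 0 := by
      simp only [Finset.sum_ite_eq, hμ, if_true, sub_self, hK0, Complex.mul_conj']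
      push_cast
      ring
    rw [this, ← Finset.sum_add_distrib]
    refine Finset.sum_congr rfl fun ν _ => ?_
    split_ifs <;> simp
  have hnorm : ‖((∫ t in (0:ℝ)..L, ‖efn lam a (γ t)‖ ^ 2 : ℝ) : ℂ) -
      ((L * ∑ μ ∈ Elat lam, ‖a μ‖ ^ 2 : ℝ) : ℂ)‖ ≤ ρ * ∑ μ ∈ Elat lam, ‖a μ‖ ^ 2 := by
    rw [hdiff]
    refine le_trans ?_ (sum_mul_mul_le_of_row_sum_le (Elat lam) (fun μ => ‖a μ‖)
      (fun μ ν => if μ = ν then 0 else ‖K (μ - ν)‖) (fun μ ν => ?_) (fun μ ν => ?_) hrow)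
    · refine (norm_sum_le _ _).trans (Finset.sum_le_sum fun μ _ => (norm_sum_le _ _).trans
        (Finset.sum_le_sum fun ν _ => ?_))
      rw [norm_mul, norm_mul, Complex.norm_conj]
      split_ifs <;> simp
    · split_ifs <;> positivity
    · simp only [eq_comm (a := μ) (b := ν)]
      rw [← neg_sub ν μ, hKneg]
  rw [← Complex.ofReal_sub, Complex.norm_real, Real.norm_eq_abs, abs_le] at hnorm
  linarith [hnorm.1]

/-- For a smooth curve with nowhere-zero curvature, the restriction `L¹` norm satisfies
`∫_C |F| ≫ ‖F‖₂ / √(#E_lam)`. -/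
theorem restriction_L1_lower_bound_via_cardE
    (L Kmin Kmax : ℝ) (γ : ℝ → ℝ × ℝ)
    (hL : 0 < L) (hKmin : 0 < Kmin)
    (hsmooth : ContDiff ℝ (⊤ : ℕ∞) γ)
    (hunit : ∀ t ∈ Set.Icc (0:ℝ) L, e2 (deriv γ t) = 1)
    (hcurv : ∀ t ∈ Set.Icc (0:ℝ) L,
      Kmin ≤ e2 (deriv (deriv γ) t) ∧ e2 (deriv (deriv γ) t) ≤ Kmax) :
    ∃ c > (0:ℝ), ∃ lam0 > (0:ℝ), ∀ lam : ℝ, lam0 ≤ lam →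
      ∀ a : ℤ × ℤ → ℂ,
        (∀ μ : ℤ × ℤ, a (-μ) = starRingEnd ℂ (a μ)) →
        (∃ μ ∈ Elat lam, a μ ≠ 0) →
        c * l2T (efn lam a) / Real.sqrt ((Elat lam).card)
          ≤ ∫ t in (0:ℝ)..L, ‖efn lam a (γ t)‖ := by
  obtain ⟨C, hC, m, hmL, hm0, hK⟩ := exists_uniform_norm_integral_exp_curve_le hL hKmin hsmooth
    hunit fun t ht => (hcurv t ht).1
  obtain ⟨C', hC', hcard⟩ := exists_card_Elat_le_rpow (ε := 1 / 12) (by norm_num)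
  obtain ⟨l, hl⟩ : ∃ l : ℝ, ∀ lam ≥ l, 2 * C' * C / (L - m) ≤ lam ^ (1 / 12 : ℝ) :=
    Filter.eventually_atTop.1 ((tendsto_rpow_atTop (by norm_num)).eventually_ge_atTop _)
  have hLm : 0 < L - m := sub_pos.2 hmL
  refine ⟨(L - m) / (4 * π), by positivity, max 1 l, by positivity, fun lam hlam a _ hne => ?_⟩
  have hlam1 : 1 ≤ lam := (le_max_left _ _).trans hlam
  have hlam0 : 0 < lam := by linarith
  set S := ∑ μ ∈ Elat lam, ‖a μ‖ ^ 2 with hS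
  set N : ℝ := ((Elat lam).card : ℝ) with hN
  have hS0 : 0 < S := by
    obtain ⟨μ, hμ, hμ0⟩ := hne
    exact Finset.sum_pos' (fun _ _ => by positivity) ⟨μ, hμ, by positivity⟩
  have hN0 : 0 < N := by
    obtain ⟨μ, hμ, _⟩ := hne
    exact Nat.cast_pos.2 (Finset.card_pos.2 ⟨μ, hμ⟩)
  have hpow : ∀ x y : ℝ, lam ^ x * lam ^ y = lam ^ (x + y) := fun x y =>
    (Real.rpow_add hlam0 x y).symm
  have hT : (lam ^ (2 / 3 : ℝ)) ^ 3 ≤ lam ^ 2 := by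
    rw [← Real.rpow_natCast, ← Real.rpow_mul hlam0.le]
    norm_num
  have hrow : ∀ μ ∈ Elat lam, ∑ ν ∈ Elat lam, (if μ = ν then 0 else
      ‖∫ t in (0:ℝ)..L, Complex.exp (Complex.I * Complex.ofReal
        (((μ - ν).1 : ℝ) * (γ t).1 + ((μ - ν).2 : ℝ) * (γ t).2))‖) ≤ (L + m) / 2 := by
    intro μ hμ
    have hterm : ∀ ν ∈ Elat lam, (if μ = ν then 0 else
        ‖∫ t in (0:ℝ)..L, Complex.exp (Complex.I * Complex.ofReal
          (((μ - ν).1 : ℝ) * (γ t).1 + ((μ - ν).2 : ℝ) * (γ t).2))‖) ≤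
        (if μ ≠ ν ∧ sqDist μ ν < lam ^ (2 / 3 : ℝ) then m else 0) + C / lam ^ (1 / 6 : ℝ) := by
      intro ν _
      have hpos : 0 ≤ C / lam ^ (1 / 6 : ℝ) := by positivity
      by_cases hμν : μ = ν
      · simpa [hμν] using hpos
      have h := hK (μ - ν) (sub_ne_zero.2 hμν)
      by_cases hnear : sqDist μ ν < lam ^ (2 / 3 : ℝ)
      · simp only [hμν, if_false, ne_eq, not_false_eq_true, hnear, and_self, if_true]
        linarith [h.1]
      · simp only [hμν, if_false, ne_eq, not_false_eq_true, hnear, and_false, zero_add]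
        refine h.2.trans ?_
        have hd : lam ^ (1 / 6 : ℝ) ≤ √(e2 (iv (μ - ν))) := by
          refine Real.le_sqrt_of_sq_le (Real.le_sqrt_of_sq_le ?_)
          rw [← pow_mul, ← Real.rpow_natCast, ← Real.rpow_mul hlam0.le]
          have : sqDist μ ν = (iv (μ - ν)).1 ^ 2 + (iv (μ - ν)).2 ^ 2 := by
            simp [sqDist, iv]
          rw [← this]
          norm_num
          exact not_lt.1 hnear
        gcongr
    refine (Finset.sum_le_sum hterm).trans ?_
    rw [Finset.sum_add_distrib, ← Finset.sum_filter, Finset.sum_const, Finset.sum_const,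
      nsmul_eq_mul, nsmul_eq_mul]
    have h1 : (((Elat lam).filter fun ν => μ ≠ ν ∧ sqDist μ ν < lam ^ (2 / 3 : ℝ)).card : ℝ) * m
        ≤ m := mul_le_of_le_one_left hm0 (by exact_mod_cast card_near_le_one hT hμ)
    have h2 : N * (C / lam ^ (1 / 6 : ℝ)) ≤ (L - m) / 2 := by
      have h3 := hl lam ((le_max_right _ _).trans hlam)
      rw [div_le_iff₀ hLm] at h3
      rw [← mul_div_assoc, div_le_iff₀ (by positivity)]
      have h4 : lam ^ (1 / 6 : ℝ) = lam ^ (1 / 12 : ℝ) * lam ^ (1 / 12 : ℝ) := by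
        rw [hpow]
        norm_num
      have hp : 0 < lam ^ (1 / 12 : ℝ) := by positivity
      calc N * C ≤ C' * lam ^ (1 / 12 : ℝ) * C := by
            gcongr
            exact hcard lam hlam0
        _ = (2 * C' * C) * (lam ^ (1 / 12 : ℝ) / 2) := by ring
        _ ≤ (lam ^ (1 / 12 : ℝ) * (L - m)) * (lam ^ (1 / 12 : ℝ) / 2) := by gcongr
        _ = _ := by rw [h4]; ring
    linarith
  have hγ := hsmooth.continuous
  have hF : Continuous fun t => efn lam a (γ t) := (continuous_efn lam a).comp hγ
  have hL2 := le_integral_norm_sq_efn hγ a hrow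
  have hL1 : ∫ t in (0:ℝ)..L, ‖efn lam a (γ t)‖ ^ 2 ≤
      √(N * S) * ∫ t in (0:ℝ)..L, ‖efn lam a (γ t)‖ := by
    rw [← intervalIntegral.integral_const_mul]
    refine intervalIntegral.integral_mono_on hL.le (Continuous.intervalIntegrable (by fun_prop) _ _)
      (Continuous.intervalIntegrable (by fun_prop) _ _) fun t _ => ?_
    rw [pow_two]
    exact mul_le_mul_of_nonneg_right (norm_efn_le lam a (γ t)) (norm_nonneg _)
  have hsS : 0 < √S := Real.sqrt_pos.2 hS0
  have hsN : 0 < √N := Real.sqrt_pos.2 hN0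
  rw [l2T_efn, ← hS, div_le_iff₀ hsN]
  rw [Real.sqrt_mul hN0.le] at hL1
  have hSS : √S * √S = S := Real.mul_self_sqrt hS0.le
  have hfin : (L - m) / 2 * (√S * √S) ≤ √N * √S * ∫ t in (0:ℝ)..L, ‖efn lam a (γ t)‖ := by
    rw [hSS]
    refine le_trans (le_of_eq ?_) (hL2.trans hL1)
    ring
  have hpi := pi_pos
  have e : (L - m) / (4 * π) * (2 * π * √S) = (L - m) / 2 * √S := by
    field_simp
    ring
  rw [e]
  refine le_of_mul_le_mul_right ?_ hsS
  linarith
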